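/- Let N ≥ 2. There does not exist a family 𝔽 of Borel functions f : ℝ^N → ℝ, each integrable with respect to every element of 𝒫^p(ℝ^N), such that for every sequence (μ_n) and every μ in 𝒫^p(ℝ^N): d_p^nd(μ_n,μ) → 0 if and only if ∫ f dμ_n → ∫ f dμ for all f ∈ 𝔽. Moreover, no such family exists even when 𝒫^p(ℝ^N) is replaced by the set of probability measures supported on [−K,K]^N for a fixed K > 0. -/

import Mathlib

open MeasureTheory ProbabilityTheory Filter
open scoped ENNReal NNReal Topology

noncomputable section

/-- `dund` is a metric on `ℝ` inducing the usual topology. -/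
structure IsCompatibleMetric (dund : ℝ → ℝ → ℝ) : Prop where
  self_eq_zero : ∀ x, dund x x = 0
  eq_of_dist_eq_zero : ∀ x y, dund x y = 0 → x = y
  symm : ∀ x y, dund x y = dund y x
  triangle : ∀ x y z, dund x z ≤ dund x y + dund y z
  compatible : ∀ (x : ℝ) (u : ℕ → ℝ),
    Tendsto u atTop (nhds x) ↔ Tendsto (fun n => dund (u n) x) atTop (nhds 0)

/-- Couplings: measures on the product with prescribed marginals. -/
def coupling {α β : Type*} [MeasurableSpace α] [MeasurableSpace β]
    (μ : Measure α) (ν : Measure β) : Set (Measure (α × β)) :=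
  {γ | γ.map Prod.fst = μ ∧ γ.map Prod.snd = ν}

/-- Projection onto the first `t` coordinates. -/
def proj (N t : ℕ) (ht : t ≤ N) (x : Fin N → ℝ) : Fin t → ℝ :=
  fun i => x (Fin.castLE ht i)

/-- The σ-algebra generated by the first `t` coordinates of the first (`x`) component. -/
def sigmaX (N t : ℕ) (ht : t ≤ N) : MeasurableSpace ((Fin N → ℝ) × (Fin N → ℝ)) :=
  MeasurableSpace.comap (fun z => proj N t ht z.1) inferInstance

/-- The σ-algebra generated by the first `t` coordinates of the second (`y`) component. -/
def sigmaY (N t : ℕ) (ht : t ≤ N) : MeasurableSpace ((Fin N → ℝ) × (Fin N → ℝ)) :=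
  MeasurableSpace.comap (fun z => proj N t ht z.2) inferInstance

/-- The σ-algebra generated by all coordinates of the first (`x`) component. -/
def sigmaXfull (N : ℕ) : MeasurableSpace ((Fin N → ℝ) × (Fin N → ℝ)) :=
  MeasurableSpace.comap Prod.fst inferInstance

/-- The σ-algebra generated by all coordinates of the second (`y`) component. -/
def sigmaYfull (N : ℕ) : MeasurableSpace ((Fin N → ℝ) × (Fin N → ℝ)) :=
  MeasurableSpace.comap Prod.snd inferInstance

/-- A coupling `γ`, viewed as the joint law of processes `X, Y`, is bicausal if for every
`t < N` and Borel `B ⊆ ℝ^t`, `ℙ((Y₁,…,Y_t) ∈ B | X₁,…,X_N) = ℙ((Y₁,…,Y_t) ∈ B | X₁,…,X_t)`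
a.s. and symmetrically in `X` and `Y`. -/
def Bicausal (N : ℕ) (γ : Measure ((Fin N → ℝ) × (Fin N → ℝ))) : Prop :=
  ∀ (t : ℕ) (ht : t < N) (B : Set (Fin t → ℝ)), MeasurableSet B →
    (γ[fun z => Set.indicator B (fun _ => (1 : ℝ)) (proj N t ht.le z.2) | sigmaXfull N]
      =ᵐ[γ]
     γ[fun z => Set.indicator B (fun _ => (1 : ℝ)) (proj N t ht.le z.2) | sigmaX N t ht.le]) ∧
    (γ[fun z => Set.indicator B (fun _ => (1 : ℝ)) (proj N t ht.le z.1) | sigmaYfull N]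
      =ᵐ[γ]
     γ[fun z => Set.indicator B (fun _ => (1 : ℝ)) (proj N t ht.le z.1) | sigmaY N t ht.le])

/-- The `p`-th power cost `d(x,y)^p = ∑_t d̲(x_t,y_t)^p`. -/
def costp (N : ℕ) (p : ℝ) (dund : ℝ → ℝ → ℝ) (z : (Fin N → ℝ) × (Fin N → ℝ)) : ℝ :=
  ∑ t : Fin N, dund (z.1 t) (z.2 t) ^ p

/-- The nested distance `d_p^nd(μ,ν) = (inf_{γ ∈ Π_bc(μ,ν)} ∫ d^p dγ)^{1/p}`. -/
def nestedDist (N : ℕ) (p : ℝ) (dund : ℝ → ℝ → ℝ)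
    (μ ν : Measure (Fin N → ℝ)) : ℝ≥0∞ :=
  (⨅ γ : {γ : Measure ((Fin N → ℝ) × (Fin N → ℝ)) // γ ∈ coupling μ ν ∧ Bicausal N γ},
      ∫⁻ z, ENNReal.ofReal (costp N p dund z) ∂(γ : Measure _)) ^ (1 / p)

/-- Membership in `𝒫^p(ℝ^N)`: a probability measure with a finite `p`-th moment. -/
def MemPp (N : ℕ) (p : ℝ) (dund : ℝ → ℝ → ℝ) (μ : Measure (Fin N → ℝ)) : Prop :=
  IsProbabilityMeasure μ ∧
    ∃ x₀ : Fin N → ℝ, ∫⁻ x, ENNReal.ofReal (costp N p dund (x, x₀)) ∂μ < ⊤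

section NestedDistance

variable {N : ℕ} {p : ℝ} {dund : ℝ → ℝ → ℝ}

theorem IsCompatibleMetric.nonneg (hd : IsCompatibleMetric dund) (x y : ℝ) : 0 ≤ dund x y := by
  have h := hd.triangle x y x
  rw [hd.self_eq_zero, hd.symm y x] at h
  linarith

theorem measurable_proj (t : ℕ) (ht : t ≤ N) : Measurable (proj N t ht) :=
  measurable_pi_lambda _ fun _ => measurable_pi_apply _

theorem sigmaX_le (t : ℕ) (ht : t ≤ N) : sigmaX N t ht ≤ Prod.instMeasurableSpace :=
  ((measurable_proj t ht).comp measurable_fst).comap_le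

theorem sigmaY_le (t : ℕ) (ht : t ≤ N) : sigmaY N t ht ≤ Prod.instMeasurableSpace :=
  ((measurable_proj t ht).comp measurable_snd).comap_le

theorem sigmaXfull_le : sigmaXfull N ≤ Prod.instMeasurableSpace := measurable_fst.comap_le

theorem sigmaYfull_le : sigmaYfull N ≤ Prod.instMeasurableSpace := measurable_snd.comap_le

theorem condExp_dirac_ae_eq {α : Type*} {m m₀ : MeasurableSpace α} [MeasurableSingletonClass α]
    (hm : m ≤ m₀) (a : α) (f : α → ℝ) :
    (Measure.dirac a)[f | m] =ᵐ[Measure.dirac a] fun _ => f a := by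
  refine (condExp_congr_ae (ae_eq_dirac f)).trans ?_
  exact (condExp_const hm (f a)).eventuallyEq

theorem condExp_dirac_ae_eq_condExp {α : Type*} {m₁ m₂ m₀ : MeasurableSpace α}
    [MeasurableSingletonClass α] (h₁ : m₁ ≤ m₀) (h₂ : m₂ ≤ m₀) (a : α) (f : α → ℝ) :
    (Measure.dirac a)[f | m₁] =ᵐ[Measure.dirac a] (Measure.dirac a)[f | m₂] :=
  (condExp_dirac_ae_eq h₁ a f).trans (condExp_dirac_ae_eq h₂ a f).symm

theorem bicausal_dirac (z : (Fin N → ℝ) × (Fin N → ℝ)) : Bicausal N (Measure.dirac z) := by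
  intro t ht B _
  constructor
  · exact condExp_dirac_ae_eq_condExp sigmaXfull_le (sigmaX_le t ht.le) z _
  · exact condExp_dirac_ae_eq_condExp sigmaYfull_le (sigmaY_le t ht.le) z _

theorem dirac_mem_coupling {α β : Type*} [MeasurableSpace α] [MeasurableSpace β] (x : α) (y : β) :
    Measure.dirac (x, y) ∈ coupling (Measure.dirac x) (Measure.dirac y) :=
  ⟨Measure.map_dirac' measurable_fst (x, y), Measure.map_dirac' measurable_snd (x, y)⟩

theorem nestedDist_dirac_le (hp : 0 ≤ p) (x y : Fin N → ℝ) :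
    nestedDist N p dund (Measure.dirac x) (Measure.dirac y) ≤
      ENNReal.ofReal (costp N p dund (x, y)) ^ (1 / p) := by
  refine ENNReal.rpow_le_rpow ?_ (by positivity)
  refine (iInf_le _ ⟨Measure.dirac (x, y), dirac_mem_coupling x y, bicausal_dirac _⟩).trans ?_
  simp

theorem tendsto_nestedDist_dirac (hp : 0 < p) (hd : IsCompatibleMetric dund)
    {x : ℕ → Fin N → ℝ} {y : Fin N → ℝ} (hx : Tendsto x atTop (𝓝 y)) :
    Tendsto (fun n => nestedDist N p dund (Measure.dirac (x n)) (Measure.dirac y))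
      atTop (𝓝 0) := by
  have hcost : Tendsto (fun n => costp N p dund (x n, y)) atTop (𝓝 0) := by
    have h : Tendsto (fun n => ∑ t : Fin N, dund (x n t) (y t) ^ p) atTop
        (𝓝 (∑ _t : Fin N, (0 : ℝ) ^ p)) :=
      tendsto_finsetSum _ fun t _ =>
        ((hd.compatible (y t) fun n => x n t).1 ((tendsto_pi_nhds.1 hx) t)).rpow_const
          (Or.inr hp.le)
    simpa [costp, Real.zero_rpow hp.ne'] using h
  have hpow := ((ENNReal.continuous_rpow_const (y := 1 / p)).tendsto _).comp
    (ENNReal.tendsto_ofReal hcost)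
  rw [ENNReal.ofReal_zero, ENNReal.zero_rpow_of_pos (by positivity)] at hpow
  exact tendsto_of_tendsto_of_tendsto_of_le_of_le tendsto_const_nhds hpow (fun _ => zero_le)
    fun n => nestedDist_dirac_le hp.le (x n) y

/-- If the first `t` coordinates of `Y` are deterministic, then under a bicausal coupling the
first `t` coordinates of `X` are independent of the whole process `Y`. -/
theorem Bicausal.measureReal_inter {γ : Measure ((Fin N → ℝ) × (Fin N → ℝ))}
    [IsProbabilityMeasure γ] (hγ : Bicausal N γ) {t : ℕ} (ht : t < N) (c : Fin N → ℝ)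
    (hc : ∀ᵐ z ∂γ, proj N t ht.le z.2 = proj N t ht.le c) {B : Set (Fin t → ℝ)}
    (hB : MeasurableSet B) {S : Set (Fin N → ℝ)} (hS : MeasurableSet S) :
    γ.real ({z | proj N t ht.le z.1 ∈ B} ∩ {z | z.2 ∈ S}) =
      γ.real {z | proj N t ht.le z.1 ∈ B} * γ.real {z | z.2 ∈ S} := by
  set A : Set ((Fin N → ℝ) × (Fin N → ℝ)) := {z | proj N t ht.le z.1 ∈ B} with hAdef
  have hA : MeasurableSet A := ((measurable_proj t ht.le).comp measurable_fst) hB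
  set f : (Fin N → ℝ) × (Fin N → ℝ) → ℝ :=
    fun z => Set.indicator B (fun _ => (1 : ℝ)) (proj N t ht.le z.1) with hfdef
  have hf : f = A.indicator 1 := by
    ext z
    by_cases hz : proj N t ht.le z.1 ∈ B <;> simp [hfdef, hAdef, hz]
  have hfi : Integrable f γ := by
    rw [hf]
    exact (integrable_const (1 : ℝ)).indicator hA
  set g := γ[f | sigmaY N t ht.le] with hgdef
  have hconst : g =ᵐ[γ] fun _ => g (c, c) := by
    have hfac : Function.FactorsThrough g
        (fun z : (Fin N → ℝ) × (Fin N → ℝ) => proj N t ht.le z.2) :=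
      (stronglyMeasurable_condExp (m := sigmaY N t ht.le)).factorsThrough
    filter_upwards [hc] with z hz
    exact hfac hz
  have hgc : g (c, c) = γ.real A := by
    have h := integral_condExp (μ := γ) (f := f) (sigmaY_le t ht.le)
    rw [← hgdef, integral_congr_ae hconst, hf, integral_indicator_one hA] at h
    simpa using h
  have hSm : MeasurableSet[sigmaYfull N] {z : (Fin N → ℝ) × (Fin N → ℝ) | z.2 ∈ S} :=
    ⟨S, hS, rfl⟩
  have hset := setIntegral_condExp (μ := γ) sigmaYfull_le hfi hSm
  have heq : γ[f | sigmaYfull N] =ᵐ[γ] fun _ => γ.real A :=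
    ((hγ t ht B hB).2.trans hconst).trans (by rw [hgc])
  rw [integral_congr_ae (ae_restrict_of_ae heq), hf, integral_indicator_one hA] at hset
  rw [measureReal_restrict_apply hA] at hset
  rw [← hset]
  simp [mul_comm]

/-- The uniform distribution on the two points `x` and `y`. -/
def twoPoint {α : Type*} [MeasurableSpace α] (x y : α) : Measure α :=
  (2⁻¹ : ℝ≥0∞) • (Measure.dirac x + Measure.dirac y)

theorem twoPoint_self {α : Type*} [MeasurableSpace α] (x : α) :
    twoPoint x x = Measure.dirac x := by
  rw [twoPoint, ← two_smul ℝ≥0∞ (Measure.dirac x), smul_smul,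
    ENNReal.inv_mul_cancel (by simp) (by simp), one_smul]

instance isProbabilityMeasure_twoPoint {α : Type*} [MeasurableSpace α] (x y : α) :
    IsProbabilityMeasure (twoPoint x y) := by
  constructor
  simp [twoPoint, ENNReal.inv_two_add_inv_two]

theorem integral_twoPoint {α : Type*} [MeasurableSpace α] [MeasurableSingletonClass α]
    (f : α → ℝ) (x y : α) : ∫ z, f z ∂(twoPoint x y) = 2⁻¹ * (f x + f y) := by
  rw [twoPoint, integral_smul_measure,
    integral_add_measure (integrable_dirac (by simp)) (integrable_dirac (by simp))]
  simp

theorem ae_twoPoint {α : Type*} [MeasurableSpace α] [MeasurableSingletonClass α]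
    {P : α → Prop} {x y : α} (hx : P x) (hy : P y) : ∀ᵐ z ∂(twoPoint x y), P z := by
  refine Measure.ae_smul_measure ?_ _
  rw [ae_add_measure_iff]
  simp [ae_dirac_eq, hx, hy]

theorem twoPoint_real_apply {α : Type*} [MeasurableSpace α] [MeasurableSingletonClass α]
    {S : Set α} {x y : α} (hx : x ∈ S) (hy : y ∉ S) : (twoPoint x y).real S = 2⁻¹ := by
  simp [twoPoint, Measure.real, hx, hy]

theorem memPp_twoPoint (x y : Fin N → ℝ) : MemPp N p dund (twoPoint x y) := by
  refine ⟨inferInstance, 0, ?_⟩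
  rw [twoPoint, lintegral_smul_measure, lintegral_add_measure]
  simp only [lintegral_dirac, smul_eq_mul]
  exact ENNReal.mul_lt_top (by simp) (by simp)

/-- The path `(s, c, 0, …, 0)`. -/
def path (N : ℕ) (s c : ℝ) : Fin N → ℝ :=
  fun i => if i.val = 0 then s else if i.val = 1 then c else 0

theorem tendsto_path {s : ℕ → ℝ} {s₀ : ℝ} (hs : Tendsto s atTop (𝓝 s₀)) (c : ℝ) :
    Tendsto (fun n => path N (s n) c) atTop (𝓝 (path N s₀ c)) := by
  refine tendsto_pi_nhds.2 fun i => ?_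
  by_cases h : i.val = 0 <;> simp [path, h, hs]

/-- A process which reveals its second coordinate at time one stays at a fixed nested distance
from the one that reveals it only at time two. -/
theorem le_nestedDist_twoPoint (hN : 2 ≤ N) (hp : 0 < p) (hd : IsCompatibleMetric dund)
    {s a : ℝ} (hs : 0 < s) (ha : 0 < a) :
    (ENNReal.ofReal (dund a (-a) ^ p) * ENNReal.ofReal 4⁻¹) ^ (1 / p) ≤
      nestedDist N p dund (twoPoint (path N s a) (path N (-s) (-a)))
        (twoPoint (path N 0 (-a)) (path N 0 a)) := by
  refine ENNReal.rpow_le_rpow (le_iInf ?_) (by positivity)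
  rintro ⟨γ, ⟨hfst, hsnd⟩, hγ⟩
  have h1N : 1 < N := hN
  let i₀ : Fin N := ⟨0, by lia⟩
  let i₁ : Fin N := ⟨1, h1N⟩
  have hprob : IsProbabilityMeasure γ := by
    have : IsProbabilityMeasure (γ.map Prod.fst) := hfst ▸ inferInstance
    exact Measure.isProbabilityMeasure_of_map Prod.fst
  have haeX {P : (Fin N → ℝ) → Prop} (h₁ : P (path N s a)) (h₂ : P (path N (-s) (-a))) :
      ∀ᵐ z ∂γ, P z.1 :=
    ae_of_ae_map measurable_fst.aemeasurable (hfst ▸ ae_twoPoint h₁ h₂)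
  have haeY {P : (Fin N → ℝ) → Prop} (h₁ : P (path N 0 (-a))) (h₂ : P (path N 0 a)) :
      ∀ᵐ z ∂γ, P z.2 :=
    ae_of_ae_map measurable_snd.aemeasurable (hsnd ▸ ae_twoPoint h₁ h₂)
  let B : Set (Fin 1 → ℝ) := {w | 0 < w 0}
  have hB : MeasurableSet B := measurableSet_lt measurable_const (measurable_pi_apply 0)
  let S : Set (Fin N → ℝ) := {y | y i₁ < 0}
  have hS : MeasurableSet S := measurableSet_lt (measurable_pi_apply i₁) measurable_const
  have hpB : MeasurableSet (proj N 1 h1N.le ⁻¹' B) := measurable_proj 1 h1N.le hB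
  have hmX : γ.real {z | proj N 1 h1N.le z.1 ∈ B} = 2⁻¹ := by
    have h := map_measureReal_apply (μ := γ) measurable_fst hpB
    rw [hfst, twoPoint_real_apply (by simpa [B, proj, path] using hs)
      (by simpa [B, proj, path] using hs.le)] at h
    exact h.symm
  have hmY : γ.real {z | z.2 ∈ S} = 2⁻¹ := by
    have h := map_measureReal_apply (μ := γ) measurable_snd hS
    rw [hsnd, twoPoint_real_apply (by simpa [S, i₁, path] using ha)
      (by simpa [S, i₁, path] using ha.le)] at h
    exact h.symm
  have hinter := hγ.measureReal_inter h1N (path N 0 a)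
    (haeY (P := fun y => proj N 1 h1N.le y = proj N 1 h1N.le (path N 0 a))
      (by ext i; simp [proj, path]) rfl) hB hS
  rw [hmX, hmY] at hinter
  set E : Set ((Fin N → ℝ) × (Fin N → ℝ)) :=
    {z | proj N 1 h1N.le z.1 ∈ B} ∩ {z | z.2 ∈ S} with hE
  have hEm : MeasurableSet E := (measurable_fst hpB).inter (measurable_snd hS)
  have hγE : γ E = ENNReal.ofReal 4⁻¹ := by
    rw [← ofReal_measureReal (s := E), hinter]
    norm_num
  rw [← hγE, ← lintegral_indicator_const hEm]
  refine lintegral_mono_ae ?_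
  have hX := haeX (P := fun x => 0 < x i₀ → x i₁ = a) (by simp [i₁, path])
    (by simp [i₀, path, not_lt.2 hs.le])
  have hY := haeY (P := fun y => y i₁ < 0 → y i₁ = -a) (by simp [i₁, path])
    (by simp [i₁, path, not_lt.2 ha.le])
  filter_upwards [hX, hY] with z hzX hzY
  by_cases hz : z ∈ E
  · rw [Set.indicator_of_mem hz]
    refine ENNReal.ofReal_le_ofReal ?_
    have h₁ : z.1 i₁ = a := hzX hz.1
    have h₂ : z.2 i₁ = -a := hzY hz.2
    have h := Finset.single_le_sum (f := fun t => dund (z.1 t) (z.2 t) ^ p)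
      (fun t _ => Real.rpow_nonneg (hd.nonneg _ _) p) (Finset.mem_univ i₁)
    simpa only [h₁, h₂, costp] using h
  · simp [Set.indicator_of_notMem hz]

/-- No family of functions determines nested convergence on a class of measures containing all
two-point measures on a cube. -/
theorem not_convergence_determining_of_twoPoint (hN : 2 ≤ N) (hp : 0 < p)
    (hd : IsCompatibleMetric dund) {a : ℝ} (ha : 0 < a) (M : Measure (Fin N → ℝ) → Prop)
    (hM : ∀ x y : Fin N → ℝ, (∀ t, x t ∈ Set.Icc (-a) a) → (∀ t, y t ∈ Set.Icc (-a) a) →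
      M (twoPoint x y)) (F : Set ((Fin N → ℝ) → ℝ)) :
    ¬ ∀ (μs : ℕ → Measure (Fin N → ℝ)) (μ : Measure (Fin N → ℝ)),
      (∀ n, M (μs n)) → M μ →
      (Tendsto (fun n => nestedDist N p dund (μs n) μ) atTop (𝓝 0) ↔
        ∀ f ∈ F, Tendsto (fun n => ∫ x, f x ∂(μs n)) atTop (𝓝 (∫ x, f x ∂μ))) := by
  intro hF
  let s : ℕ → ℝ := fun n => a * (1 / ((n : ℝ) + 1))
  have hs_pos (n : ℕ) : 0 < s n := by positivity
  have hs_le (n : ℕ) : s n ≤ a := by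
    have h : 1 / ((n : ℝ) + 1) ≤ 1 := by
      rw [div_le_one (by positivity)]
      linarith [n.cast_nonneg (α := ℝ)]
    simpa [s] using mul_le_mul_of_nonneg_left h ha.le
  have hs : Tendsto s atTop (𝓝 0) := by
    simpa [s] using tendsto_one_div_add_atTop_nhds_zero_nat.const_mul a
  have hbox {u c : ℝ} (hu : |u| ≤ a) (hc : |c| ≤ a) (t : Fin N) :
      path N u c t ∈ Set.Icc (-a) a := by
    rw [Set.mem_Icc, ← abs_le]
    unfold path
    split_ifs <;> simp [hu, hc, ha.le]
  have hsa (n : ℕ) : |s n| ≤ a := by rw [abs_of_pos (hs_pos n)]; exact hs_le n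
  have haa : |a| ≤ a := (abs_of_pos ha).le
  have hzero : |(0 : ℝ)| ≤ a := by simpa using ha.le
  have hcont {u : ℕ → ℝ} {c : ℝ} (hu : Tendsto u atTop (𝓝 0)) (hua : ∀ n, |u n| ≤ a)
      (hc : |c| ≤ a) {f : (Fin N → ℝ) → ℝ} (hf : f ∈ F) :
      Tendsto (fun n => f (path N (u n) c)) atTop (𝓝 (f (path N 0 c))) := by
    have hMd (v : ℝ) (hv : |v| ≤ a) : M (Measure.dirac (path N v c)) :=
      twoPoint_self (path N v c) ▸ hM _ _ (hbox hv hc) (hbox hv hc)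
    have h := (hF _ _ (fun n => hMd (u n) (hua n)) (hMd 0 hzero)).1
      (tendsto_nestedDist_dirac hp hd (tendsto_path hu c)) f hf
    simpa using h
  have hlim := (hF (fun n => twoPoint (path N (s n) a) (path N (-s n) (-a)))
    (twoPoint (path N 0 (-a)) (path N 0 a))
    (fun n => hM _ _ (hbox (hsa n) haa) (hbox (by simpa using hsa n) (by simpa using haa)))
    (hM _ _ (hbox hzero (by simpa using haa)) (hbox hzero haa))).2 fun f hf => by
      simp only [integral_twoPoint]
      rw [add_comm (f (path N 0 (-a)))]
      refine ((hcont hs hsa haa hf).add (hcont ?_ (by simpa using hsa) (by simpa using haa)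
        hf)).const_mul _
      simpa using hs.neg
  have hle := ge_of_tendsto' hlim fun n => le_nestedDist_twoPoint hN hp hd (hs_pos n) ha
  have hne : dund a (-a) ≠ 0 := fun h => by
    linarith [hd.eq_of_dist_eq_zero _ _ h]
  have hdpos : 0 < dund a (-a) ^ p :=
    Real.rpow_pos_of_pos (lt_of_le_of_ne (hd.nonneg _ _) hne.symm) p
  refine hle.not_gt (ENNReal.rpow_pos ?_ ?_)
  · exact ENNReal.mul_pos (by simpa using hdpos) (by simp)
  · exact ENNReal.mul_ne_top ENNReal.ofReal_ne_top ENNReal.ofReal_ne_top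

end NestedDistance

/-- for `N ≥ 2` there is no family of Borel functions (integrable w.r.t. every
element of `𝒫^p(ℝ^N)`) whose integrals determine convergence in nested distance; and this
remains true when `𝒫^p(ℝ^N)` is replaced by the probability measures supported on
`[-K,K]^N` for any fixed `K > 0`. -/
theorem no_convergence_determining_family (N : ℕ) (hN : 2 ≤ N) (p : ℝ) (hp : 1 ≤ p)
    (dund : ℝ → ℝ → ℝ) (hd : IsCompatibleMetric dund) :
    (¬ ∃ F : Set ((Fin N → ℝ) → ℝ),
        (∀ f ∈ F, Measurable f ∧
          ∀ μ : Measure (Fin N → ℝ), MemPp N p dund μ → Integrable f μ) ∧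
        ∀ (μs : ℕ → Measure (Fin N → ℝ)) (μ : Measure (Fin N → ℝ)),
          (∀ n, MemPp N p dund (μs n)) → MemPp N p dund μ →
          (Tendsto (fun n => nestedDist N p dund (μs n) μ) atTop (nhds 0) ↔
            ∀ f ∈ F, Tendsto (fun n => ∫ x, f x ∂(μs n)) atTop (nhds (∫ x, f x ∂μ)))) ∧
    (∀ K : ℝ, 0 < K →
      ¬ ∃ F : Set ((Fin N → ℝ) → ℝ),
        (∀ f ∈ F, Measurable f ∧
          ∀ μ : Measure (Fin N → ℝ), IsProbabilityMeasure μ →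
            μ {x | ∀ t, x t ∈ Set.Icc (-K) K} = 1 → Integrable f μ) ∧
        ∀ (μs : ℕ → Measure (Fin N → ℝ)) (μ : Measure (Fin N → ℝ)),
          (∀ n, IsProbabilityMeasure (μs n)) →
          (∀ n, (μs n) {x | ∀ t, x t ∈ Set.Icc (-K) K} = 1) →
          IsProbabilityMeasure μ → μ {x | ∀ t, x t ∈ Set.Icc (-K) K} = 1 →
          (Tendsto (fun n => nestedDist N p dund (μs n) μ) atTop (nhds 0) ↔
            ∀ f ∈ F, Tendsto (fun n => ∫ x, f x ∂(μs n)) atTop (nhds (∫ x, f x ∂μ)))) := by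
  have hp₀ : 0 < p := by linarith
  refine ⟨?_, fun K hK => ?_⟩
  · rintro ⟨F, -, hF⟩
    exact not_convergence_determining_of_twoPoint hN hp₀ hd one_pos (MemPp N p dund)
      (fun x y _ _ => memPp_twoPoint x y) F hF
  · rintro ⟨F, -, hF⟩
    refine not_convergence_determining_of_twoPoint hN hp₀ hd hK
      (fun μ => IsProbabilityMeasure μ ∧ μ {x | ∀ t, x t ∈ Set.Icc (-K) K} = 1)
      (fun x y hx hy => ⟨inferInstance, ?_⟩) F
      fun μs μ hμs hμ => hF μs μ (fun n => (hμs n).1) (fun n => (hμs n).2) hμ.1 hμ.2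
    have h : ∀ᵐ z ∂(twoPoint x y), z ∈ {x : Fin N → ℝ | ∀ t, x t ∈ Set.Icc (-K) K} :=
      ae_twoPoint hx hy
    rw [measure_eq_measure_of_null_sdiff (Set.subset_univ _), measure_univ]
    rw [← Set.compl_eq_univ_sdiff]
    exact h
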